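/- arXiv:1906.11469 — 7 statements merged into one kernel-verified Lean document; each statement's English description precedes it below -/
import Mathlib

section
/- Let G be a finite abelian group and let K1, K2, K3 be cyclic subgroups of G such that Ki ∩ Kj = {1} for all i ≠ j. Let σ1, σ2, σ3 ∈ G be elements with σi ∉ Ki for each i, and assume the following freeness condition: the only element g ∈ G whose image in G/Ki lies in the cyclic subgroup generated by the image of σi for every i = 1, 2, 3 is g = 1. Let I(σ1,σ2,σ3) be the set of triples (χ1, χ2, χ3) of characters of G such that Ki ⊆ ker χi for each i, the pointwise product χ1·χ2·χ3 is the trivial character, and χi(σi) ≠ 1 for each i. Let G(σ1,σ2,σ3) = {(τ1,τ2,τ3) ∈ G×G×G : χ1(τ1)·χ2(τ2)·χ3(τ3) = 1 for every (χ1,χ2,χ3) ∈ I(σ1,σ2,σ3)}. Then the quotient group G(σ1,σ2,σ3)/KΔ_G is either trivial or a 2-elementary abelian group; equivalently, for every (τ1,τ2,τ3) ∈ G(σ1,σ2,σ3) one has (τ1², τ2², τ3²) ∈ KΔ_G. -/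
/-- If three homomorphisms out of an abelian group have a product image (`split₁`, `split₂`,
`split₃`) and are nontrivial, then a homomorphism that is trivial at every element where none of
the three takes the value `1` is trivial on squares. -/
theorem MonoidHom.sq_apply_eq_one_of_forall_ne_one {A M N : Type*} [CommGroup A] [CommGroup M]
    [CommGroup N] (ψ₁ ψ₂ ψ₃ : A →* M) (φ : A →* N)
    (split₁ : ∀ a, ∃ b, ψ₁ b = ψ₁ a ∧ ψ₂ b = 1 ∧ ψ₃ b = 1)
    (split₂ : ∀ a, ∃ b, ψ₁ b = 1 ∧ ψ₂ b = ψ₂ a ∧ ψ₃ b = 1)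
    (split₃ : ∀ a, ∃ b, ψ₁ b = 1 ∧ ψ₂ b = 1 ∧ ψ₃ b = ψ₃ a)
    (ne₁ : ∃ a, ψ₁ a ≠ 1) (ne₂ : ∃ a, ψ₂ a ≠ 1) (ne₃ : ∃ a, ψ₃ a ≠ 1)
    (hφ : ∀ a, ψ₁ a ≠ 1 → ψ₂ a ≠ 1 → ψ₃ a ≠ 1 → φ a = 1) (a : A) : φ a ^ 2 = 1 := by
  obtain ⟨u₁, hu₁⟩ := ne₁
  obtain ⟨u₂, hu₂⟩ := ne₂
  obtain ⟨u₃, hu₃⟩ := ne₃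
  obtain ⟨v₁, hv₁₁, hv₁₂, hv₁₃⟩ := split₁ u₁
  obtain ⟨v₂, hv₂₁, hv₂₂, hv₂₃⟩ := split₂ u₂
  obtain ⟨v₃, hv₃₁, hv₃₂, hv₃₃⟩ := split₃ u₃
  obtain ⟨a₁, ha₁₁, ha₁₂, ha₁₃⟩ := split₁ a
  obtain ⟨a₂, ha₂₁, ha₂₂, ha₂₃⟩ := split₂ a
  obtain ⟨a₃, ha₃₁, ha₃₂, ha₃₃⟩ := split₃ a
  have huv : φ (v₁ * v₂ * v₃) = 1 := hφ _ (by simp [*]) (by simp [*]) (by simp [*])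
  have hker : ∀ b, ψ₁ b = 1 → ψ₂ b = 1 → ψ₃ b = 1 → φ b = 1 := fun b h₁ h₂ h₃ => by
    have h : φ (b * (v₁ * v₂ * v₃)) = 1 := hφ _ (by simp [*]) (by simp [*]) (by simp [*])
    rwa [map_mul, huv, mul_one] at h
  have sq_of : ∀ b v w, φ (b * (v * w)) = 1 → φ (b * (v * w)⁻¹) = 1 → φ b ^ 2 = 1 :=
    fun b v w h h' => by
      rw [map_mul] at h h'
      rw [map_inv] at h'
      calc φ b ^ 2 = (φ b * φ (v * w)) * (φ b * (φ (v * w))⁻¹) := by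
            rw [mul_mul_mul_comm, mul_inv_cancel, mul_one, sq]
        _ = 1 := by rw [h, h', one_mul]
  have h₁ : φ a₁ ^ 2 = 1 := by
    by_cases h : ψ₁ a₁ = 1
    · rw [hker a₁ h ha₁₂ ha₁₃, one_pow]
    · rw [ha₁₁] at h
      exact sq_of a₁ v₂ v₃ (hφ _ (by simp [*]) (by simp [*]) (by simp [*]))
        (hφ _ (by simp [*]) (by simp [*]) (by simp [*]))
  have h₂ : φ a₂ ^ 2 = 1 := by
    by_cases h : ψ₂ a₂ = 1
    · rw [hker a₂ ha₂₁ h ha₂₃, one_pow]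
    · rw [ha₂₂] at h
      exact sq_of a₂ v₁ v₃ (hφ _ (by simp [*]) (by simp [*]) (by simp [*]))
        (hφ _ (by simp [*]) (by simp [*]) (by simp [*]))
  have h₃ : φ a₃ ^ 2 = 1 := by
    by_cases h : ψ₃ a₃ = 1
    · rw [hker a₃ ha₃₁ ha₃₂ h, one_pow]
    · rw [ha₃₃] at h
      exact sq_of a₃ v₁ v₂ (hφ _ (by simp [*]) (by simp [*]) (by simp [*]))
        (hφ _ (by simp [*]) (by simp [*]) (by simp [*]))
  have h : φ (a * (a₁ * a₂ * a₃)⁻¹) = 1 :=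
    hker _ (by simp [*]) (by simp [*]) (by simp [*])
  rw [map_mul, map_inv, mul_inv_eq_one] at h
  simp [h, mul_pow, h₁, h₂, h₃]

/-- If three subgroups of a finite abelian group intersect trivially, then their annihilators
generate the group of characters. -/
theorem CommGroup.exists_mul_eq_one_of_inf_eq_bot {G : Type*} [CommGroup G] [Finite G]
    {L₁ L₂ L₃ : Subgroup G} (hL : L₁ ⊓ L₂ ⊓ L₃ = ⊥) (χ : G →* ℂˣ) :
    ∃ β₁ β₂ β₃ : G →* ℂˣ, (∀ g ∈ L₁, β₁ g = 1) ∧ (∀ g ∈ L₂, β₂ g = 1) ∧ (∀ g ∈ L₃, β₃ g = 1) ∧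
      ∀ g, χ g * β₁ g * β₂ g * β₃ g = 1 := by
  let ann (L : Subgroup G) : Subgroup (G →* ℂˣ) := (MonoidHom.domRestrictHom L ℂˣ).ker
  have mem_ann (L : Subgroup G) (β : G →* ℂˣ) : β ∈ ann L ↔ ∀ g ∈ L, β g = 1 := by
    simp [ann, MonoidHom.mem_ker, MonoidHom.domRestrict_eq_one_iff]
  have key : χ⁻¹ ∈ ann L₁ ⊔ ann L₂ ⊔ ann L₃ := by
    have : HasEnoughRootsOfUnity ℂ (Monoid.exponent (G →* ℂˣ)) := by
      rw [Monoid.exponent_eq_of_mulEquiv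
        (CommGroup.monoidHom_mulEquiv_of_hasEnoughRootsOfUnity G ℂ).some]
      infer_instance
    rw [← CommGroup.forall_monoidHom_apply_eq_one_iff ℂ]
    intro η hη
    obtain ⟨g, rfl⟩ := (CommGroup.monoidHomMonoidHomEquiv G ℂ).symm.surjective η
    have mem (L : Subgroup G) (h : ann L ≤ ann L₁ ⊔ ann L₂ ⊔ ann L₃) : g ∈ L := by
      rw [← CommGroup.forall_monoidHom_apply_eq_one_iff ℂ]
      intro β hβ
      simpa using hη β (h ((mem_ann L β).2 hβ))
    have hg : g ∈ L₁ ⊓ L₂ ⊓ L₃ :=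
      ⟨⟨mem _ (le_sup_left.trans le_sup_left), mem _ (le_sup_right.trans le_sup_left)⟩,
        mem _ le_sup_right⟩
    rw [hL, Subgroup.mem_bot] at hg
    simp [hg]
  obtain ⟨y, hy, β₃, h₃, hyβ⟩ := Subgroup.mem_sup.1 key
  obtain ⟨β₁, h₁, β₂, h₂, rfl⟩ := Subgroup.mem_sup.1 hy
  refine ⟨β₁, β₂, β₃, (mem_ann _ _).1 h₁, (mem_ann _ _).1 h₂, (mem_ann _ _).1 h₃, fun g => ?_⟩
  have hg : β₁ g * β₂ g * β₃ g = (χ g)⁻¹ := DFunLike.congr_fun hyβ g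
  rw [mul_assoc, mul_assoc, ← mul_assoc (β₁ g), hg, mul_inv_cancel]

/-- The triples of characters `(χ₁, χ₂, χ₃)` with product `1` such that `χᵢ` is trivial
on `Kᵢ`. -/
def charTriples {G : Type*} [CommGroup G] (K₁ K₂ K₃ : Subgroup G) :
    Subgroup ((G →* ℂˣ) × (G →* ℂˣ) × (G →* ℂˣ)) where
  carrier := {χ | (∀ g ∈ K₁, χ.1 g = 1) ∧ (∀ g ∈ K₂, χ.2.1 g = 1) ∧ (∀ g ∈ K₃, χ.2.2 g = 1) ∧
    ∀ g, χ.1 g * χ.2.1 g * χ.2.2 g = 1}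
  one_mem' := by simp
  mul_mem' := by
    rintro χ χ' ⟨h₁, h₂, h₃, h⟩ ⟨h₁', h₂', h₃', h'⟩
    refine ⟨fun g hg => by simp [h₁ g hg, h₁' g hg], fun g hg => by simp [h₂ g hg, h₂' g hg],
      fun g hg => by simp [h₃ g hg, h₃' g hg], fun g => ?_⟩
    simp only [Prod.fst_mul, Prod.snd_mul, MonoidHom.mul_apply]
    rw [mul_mul_mul_comm (χ.1 g), mul_mul_mul_comm (χ.1 g * _), h, h', one_mul]
  inv_mem' := by
    rintro χ ⟨h₁, h₂, h₃, h⟩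
    refine ⟨fun g hg => by simp [h₁ g hg], fun g hg => by simp [h₂ g hg],
      fun g hg => by simp [h₃ g hg], fun g => ?_⟩
    simp only [Prod.fst_inv, Prod.snd_inv, MonoidHom.inv_apply]
    rw [← mul_inv, ← mul_inv, h, inv_one]


/-- Let `G` be a finite abelian group, `K1, K2, K3` cyclic subgroups with
pairwise trivial intersections, and `σ1, σ2, σ3 ∈ G` with `σi ∉ Ki`, satisfying the freeness
condition.  If `(τ1, τ2, τ3)` lies in `G(σ1,σ2,σ3)` (i.e. is annihilated by every admissible
triple of characters of the given kind), then `(τ1², τ2², τ3²) ∈ KΔ_G`; equivalently the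
quotient `G(σ1,σ2,σ3)/KΔ_G` is trivial or `2`-elementary abelian. -/
theorem stmt0 {G : Type*} [CommGroup G] [Finite G]
    (K1 K2 K3 : Subgroup G)
    (hc1 : IsCyclic K1) (hc2 : IsCyclic K2) (hc3 : IsCyclic K3)
    (h12 : K1 ⊓ K2 = ⊥) (h13 : K1 ⊓ K3 = ⊥) (h23 : K2 ⊓ K3 = ⊥)
    (σ1 σ2 σ3 : G) (hσ1 : σ1 ∉ K1) (hσ2 : σ2 ∉ K2) (hσ3 : σ3 ∉ K3)
    (hfree : ∀ g : G,
      (QuotientGroup.mk g : G ⧸ K1) ∈ Subgroup.zpowers (QuotientGroup.mk σ1 : G ⧸ K1) →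
      (QuotientGroup.mk g : G ⧸ K2) ∈ Subgroup.zpowers (QuotientGroup.mk σ2 : G ⧸ K2) →
      (QuotientGroup.mk g : G ⧸ K3) ∈ Subgroup.zpowers (QuotientGroup.mk σ3 : G ⧸ K3) →
      g = 1)
    (KΔ : Subgroup (G × G × G))
    (hKΔ : KΔ = Subgroup.closure
      ({x | x.1 ∈ K1 ∧ x.2.1 ∈ K2 ∧ x.2.2 ∈ K3} ∪ {x | ∃ g : G, x = (g, g, g)}))
    (τ1 τ2 τ3 : G)
    (hτ : ∀ χ1 χ2 χ3 : G →* ℂˣ,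
      K1 ≤ χ1.ker → K2 ≤ χ2.ker → K3 ≤ χ3.ker →
      (∀ g : G, χ1 g * χ2 g * χ3 g = 1) →
      χ1 σ1 ≠ 1 → χ2 σ2 ≠ 1 → χ3 σ3 ≠ 1 →
      χ1 τ1 * χ2 τ2 * χ3 τ3 = 1) :
    (τ1 ^ 2, τ2 ^ 2, τ3 ^ 2) ∈ KΔ := by
  let L (K : Subgroup G) (σ : G) : Subgroup G :=
    (Subgroup.zpowers (QuotientGroup.mk σ : G ⧸ K)).comap (QuotientGroup.mk' K)
  have hL : L K1 σ1 ⊓ L K2 σ2 ⊓ L K3 σ3 = ⊥ :=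
    (Subgroup.eq_bot_iff_forall _).2 fun g hg => hfree g hg.1.1 hg.1.2 hg.2
  have hKL (K : Subgroup G) (σ g : G) (hg : g ∈ K) : g ∈ L K σ := by
    simp [L, Subgroup.mem_comap, (QuotientGroup.eq_one_iff g).2 hg, one_mem]
  have hσL (K : Subgroup G) (σ : G) : σ ∈ L K σ := Subgroup.mem_zpowers _
  have sep (K : Subgroup G) (σ : G) (hσ : σ ∉ K) :
      ∃ χ : G →* ℂˣ, (∀ g ∈ K, χ g = 1) ∧ χ σ ≠ 1 := by
    rw [← CommGroup.forall_monoidHom_apply_eq_one_iff ℂ] at hσ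
    push Not at hσ
    exact hσ
  let A := charTriples K1 K2 K3
  let ev (g : G) : (G →* ℂˣ) →* ℂˣ := MonoidHom.eval g
  let ψ1 : A →* ℂˣ := ((ev σ1).comp (MonoidHom.fst _ _)).comp A.subtype
  let ψ2 : A →* ℂˣ :=
    ((ev σ2).comp ((MonoidHom.fst _ _).comp (MonoidHom.snd _ _))).comp A.subtype
  let ψ3 : A →* ℂˣ :=
    ((ev σ3).comp ((MonoidHom.snd _ _).comp (MonoidHom.snd _ _))).comp A.subtype
  let φ : A →* ℂˣ :=
    ((ev τ1).coprod ((ev τ2).coprod (ev τ3))).comp A.subtype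
  have lift1 (χ : G →* ℂˣ) (hχ : ∀ g ∈ K1, χ g = 1) :
      ∃ b, ψ1 b = χ σ1 ∧ ψ2 b = 1 ∧ ψ3 b = 1 := by
    obtain ⟨β1, β2, β3, h1, h2, h3, h⟩ := CommGroup.exists_mul_eq_one_of_inf_eq_bot hL χ
    refine ⟨⟨(χ * β1, β2, β3), fun g hg => ?_, fun g hg => h2 g (hKL _ _ g hg),
      fun g hg => h3 g (hKL _ _ g hg), h⟩, ?_,
      h2 _ (hσL _ _), h3 _ (hσL _ _)⟩
    · simp [hχ g hg, h1 g (hKL _ _ g hg)]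
    · simp [ψ1, ev, h1 _ (hσL _ _)]
  have lift2 (χ : G →* ℂˣ) (hχ : ∀ g ∈ K2, χ g = 1) :
      ∃ b, ψ1 b = 1 ∧ ψ2 b = χ σ2 ∧ ψ3 b = 1 := by
    obtain ⟨β1, β2, β3, h1, h2, h3, h⟩ := CommGroup.exists_mul_eq_one_of_inf_eq_bot hL χ
    refine ⟨⟨(β1, χ * β2, β3), fun g hg => h1 g (hKL _ _ g hg), fun g hg => ?_,
      fun g hg => h3 g (hKL _ _ g hg), fun g => by
        rw [← h g, MonoidHom.mul_apply, mul_left_comm, mul_assoc (χ g)]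
        simp only [mul_assoc]⟩,
      h1 _ (hσL _ _), ?_, h3 _ (hσL _ _)⟩
    · simp [hχ g hg, h2 g (hKL _ _ g hg)]
    · simp [ψ2, ev, h2 _ (hσL _ _)]
  have lift3 (χ : G →* ℂˣ) (hχ : ∀ g ∈ K3, χ g = 1) :
      ∃ b, ψ1 b = 1 ∧ ψ2 b = 1 ∧ ψ3 b = χ σ3 := by
    obtain ⟨β1, β2, β3, h1, h2, h3, h⟩ := CommGroup.exists_mul_eq_one_of_inf_eq_bot hL χ
    refine ⟨⟨(β1, β2, χ * β3), fun g hg => h1 g (hKL _ _ g hg),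
      fun g hg => h2 g (hKL _ _ g hg), fun g hg => ?_, fun g => by
        rw [← h g, MonoidHom.mul_apply, mul_left_comm]
        simp only [mul_assoc]⟩,
      h1 _ (hσL _ _), h2 _ (hσL _ _), ?_⟩
    · simp [hχ g hg, h3 g (hKL _ _ g hg)]
    · simp [ψ3, ev, h3 _ (hσL _ _)]
  have main := MonoidHom.sq_apply_eq_one_of_forall_ne_one ψ1 ψ2 ψ3 φ
    (fun a : A => lift1 _ a.2.1) (fun a : A => lift2 _ a.2.2.1)
    (fun a : A => lift3 _ a.2.2.2.1)
    (by
      obtain ⟨χ, hχ, hne⟩ := sep K1 σ1 hσ1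
      obtain ⟨b, hb, -, -⟩ := lift1 χ hχ
      exact ⟨b, hb ▸ hne⟩)
    (by
      obtain ⟨χ, hχ, hne⟩ := sep K2 σ2 hσ2
      obtain ⟨b, -, hb, -⟩ := lift2 χ hχ
      exact ⟨b, hb ▸ hne⟩)
    (by
      obtain ⟨χ, hχ, hne⟩ := sep K3 σ3 hσ3
      obtain ⟨b, -, -, hb⟩ := lift3 χ hχ
      exact ⟨b, hb ▸ hne⟩)
    (fun a h1 h2 h3 => by
      have h := hτ a.1.1 a.1.2.1 a.1.2.2 a.2.1 a.2.2.1 a.2.2.2.1 a.2.2.2.2 h1 h2 h3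
      rw [mul_assoc] at h
      exact h)
  rw [← CommGroup.forall_monoidHom_apply_eq_one_iff ℂ]
  intro θ hθ
  have hθK (x y z : G) (hx : x ∈ K1) (hy : y ∈ K2) (hz : z ∈ K3) : θ (x, y, z) = 1 :=
    hθ _ (hKΔ ▸ Subgroup.subset_closure (Or.inl ⟨hx, hy, hz⟩))
  have hθΔ (g : G) : θ (g, g, g) = 1 :=
    hθ _ (hKΔ ▸ Subgroup.subset_closure (Or.inr ⟨g, rfl⟩))
  have h := main ⟨(θ.comp (MonoidHom.inl G (G × G)),
    θ.comp ((MonoidHom.inr G (G × G)).comp (MonoidHom.inl G G)),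
    θ.comp ((MonoidHom.inr G (G × G)).comp (MonoidHom.inr G G))),
    fun g hg => hθK _ _ _ hg (one_mem _) (one_mem _),
    fun g hg => hθK _ _ _ (one_mem _) hg (one_mem _),
    fun g hg => hθK _ _ _ (one_mem _) (one_mem _) hg,
    fun g => by simp [← map_mul, hθΔ]⟩
  simpa [φ, ev, ← map_mul, ← map_pow] using h
end

section
/- Let G be a finite abelian group and let σ1, σ2, τ ∈ G be nontrivial elements such that the order of τ is strictly greater than 2, τ lies in the subgroup ⟨σ1, σ2⟩ generated by σ1 and σ2, and ⟨σ1, σ2⟩ is not cyclic. Then there exist characters φ1, φ2, χ of G such that: (i) χ(τ) ≠ 1; (ii) φ1(σ1) ≠ 1, φ2(σ2) ≠ 1, and φ1(σ2) = φ2(σ1) = 1; (iii) φ1(σ1)·χ(σ1) ≠ 1 and φ2(σ2)·χ(σ2)⁻¹ ≠ 1. -/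
open Subgroup in
/-- Characters of a finite abelian group that are trivial on `b` separate `x` from `1`
when `x` is not a power of `b`. -/
lemma exists_character_apply_ne_one {G : Type*} [CommGroup G] [Finite G] {x b : G}
    (h : x ∉ zpowers b) : ∃ φ : G →* ℂˣ, φ b = 1 ∧ φ x ≠ 1 := by
  by_contra! hc
  refine h ((CommGroup.forall_monoidHom_apply_eq_one_iff (M := ℂ) (zpowers b) x).1 ?_)
  intro φ hφ
  exact hc φ (hφ b (mem_zpowers b))

open Subgroup in
lemma exists_character_avoiding {G : Type*} [CommGroup G] [Finite G] {a b : G} {c : ℂˣ}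
    (h : a ∉ zpowers b) (hc : a ^ 2 ∈ zpowers b → c ^ 2 = 1 → c = 1) :
    ∃ φ : G →* ℂˣ, φ b = 1 ∧ φ a ≠ 1 ∧ φ a * c ≠ 1 := by
  by_cases h2 : a ^ 2 ∈ zpowers b
  · obtain ⟨φ, hb, ha⟩ := exists_character_apply_ne_one h
    refine ⟨φ, hb, ha, fun hm => ?_⟩
    have hsq : φ a ^ 2 = 1 := by
      obtain ⟨k, hk⟩ := mem_zpowers_iff.1 h2
      rw [← map_pow, ← hk, map_zpow, hb, one_zpow]
    have hc2 : c ^ 2 = 1 := by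
      have := congrArg (· ^ 2) hm
      simpa [mul_pow, hsq] using this
    rw [hc h2 hc2, mul_one] at hm
    exact ha hm
  · obtain ⟨φ, hb, ha⟩ := exists_character_apply_ne_one h2
    rw [map_pow] at ha
    have ha1 : φ a ≠ 1 := fun h1 => ha (by rw [h1, one_pow])
    by_cases hm : φ a * c = 1
    · refine ⟨φ ^ 2, by simp [hb], by simpa using ha, ?_⟩
      rwa [MonoidHom.pow_apply, pow_two, mul_assoc, hm, mul_one]
    · exact ⟨φ, hb, ha1, hm⟩

open Subgroup in
lemma MonoidHom.sq_apply_eq_one_of_sq_mem_zpowers {G H : Type*} [Group G] [Group H] {a b : G}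
    (h : a ∉ zpowers b) (hab : a ^ 2 ∈ zpowers b) (hba : b ^ 2 ∈ zpowers a)
    (φ : G →* H) (ha : φ a ^ 2 = 1) : φ b ^ 2 = 1 := by
  obtain ⟨k, hk⟩ := mem_zpowers_iff.1 hba
  rw [← map_pow, ← hk, map_zpow]
  obtain ⟨m, rfl | rfl⟩ := Int.even_or_odd' k
  · rw [zpow_mul, zpow_ofNat, ha, one_zpow]
  · refine absurd ?_ h
    have hb : a ^ (2 * m + 1) ∈ zpowers b := hk ▸ pow_mem (mem_zpowers b) 2
    rw [zpow_add, zpow_one, zpow_mul, zpow_ofNat] at hb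
    exact (mul_mem_cancel_left (zpow_mem hab m)).1 hb

open Subgroup in
/-- A character nontrivial on `t` whose value at `a` (resp. `b`) is not `-1` if `a ^ 2` is a
power of `b` (resp. `b ^ 2` is a power of `a`). -/
lemma exists_character_apply_ne_neg_one {G : Type*} [CommGroup G] [Finite G] {a b t : G}
    (ha : a ∉ zpowers b) (hb : b ∉ zpowers a) (ht : t ^ 2 ≠ 1) :
    ∃ χ : G →* ℂˣ, χ t ≠ 1 ∧ (a ^ 2 ∈ zpowers b → χ a ^ 2 = 1 → χ a = 1) ∧
      (b ^ 2 ∈ zpowers a → χ b ^ 2 = 1 → χ b = 1) := by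
  obtain ⟨χ, -, hχ⟩ := exists_character_apply_ne_one (x := t ^ 2) (b := 1) (by simpa using ht)
  rw [map_pow] at hχ
  have hχ1 : χ t ≠ 1 := fun h1 => hχ (by rw [h1, one_pow])
  by_cases h1 : a ^ 2 ∈ zpowers b → χ a ^ 2 = 1 → χ a = 1
  · by_cases h2 : b ^ 2 ∈ zpowers a → χ b ^ 2 = 1 → χ b = 1
    · exact ⟨χ, hχ1, h1, h2⟩
    · push Not at h2
      exact ⟨χ ^ 2, hχ,
        fun h _ => χ.sq_apply_eq_one_of_sq_mem_zpowers hb h2.1 h h2.2.1, fun _ _ => h2.2.1⟩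
  · push Not at h1
    exact ⟨χ ^ 2, hχ, fun _ _ => h1.2.1,
      fun h _ => χ.sq_apply_eq_one_of_sq_mem_zpowers ha h1.1 h h1.2.1⟩

open Subgroup in
lemma notMem_zpowers_of_not_isCyclic_closure_pair {G : Type*} [Group G] {a b : G}
    (h : ¬ IsCyclic (closure {a, b} : Subgroup G)) : a ∉ zpowers b := by
  intro hab
  have heq : closure {a, b} = zpowers b := by
    apply le_antisymm
    · rw [closure_le]
      rintro x (rfl | rfl)
      · exact hab
      · exact mem_zpowers _
    · rw [zpowers_le]
      exact subset_closure (by simp)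
  rw [heq] at h
  exact h inferInstance

/-- Lemma 4.13(1). Let `G` be a finite abelian group, `σ1, σ2, τ` nontrivial
elements of `G` with `orderOf τ > 2`, `τ ∈ ⟨σ1, σ2⟩` and `⟨σ1, σ2⟩` not cyclic (rank 2).
Then there are characters `φ1, φ2, χ : G → ℂ*` with (i) `χ(τ) ≠ 1`; (ii) `φ1(σ1) ≠ 1`,
`φ2(σ2) ≠ 1`, `φ1(σ2) = φ2(σ1) = 1`; (iii) `φ1(σ1)·χ(σ1) ≠ 1` and `φ2(σ2)·χ(σ2)⁻¹ ≠ 1`. -/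
theorem stmt1 {G : Type*} [CommGroup G] [Finite G]
    (σ1 σ2 τ : G) (hσ1 : σ1 ≠ 1) (hσ2 : σ2 ≠ 1) (hτne : τ ≠ 1)
    (hord : 2 < orderOf τ)
    (hmem : τ ∈ Subgroup.closure {σ1, σ2})
    (hrank : ¬ IsCyclic (Subgroup.closure {σ1, σ2} : Subgroup G)) :
    ∃ φ1 φ2 χ : G →* ℂˣ,
      χ τ ≠ 1 ∧
      (φ1 σ1 ≠ 1 ∧ φ2 σ2 ≠ 1 ∧ φ1 σ2 = 1 ∧ φ2 σ1 = 1) ∧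
      (φ1 σ1 * χ σ1 ≠ 1 ∧ φ2 σ2 * (χ σ2)⁻¹ ≠ 1) := by
  have h1 := notMem_zpowers_of_not_isCyclic_closure_pair hrank
  have h2 : σ2 ∉ Subgroup.zpowers σ1 :=
    notMem_zpowers_of_not_isCyclic_closure_pair (by rwa [Set.pair_comm])
  have ht : τ ^ 2 ≠ 1 := fun h => by
    have := orderOf_le_of_pow_eq_one two_pos h
    omega
  obtain ⟨χ, hχ, hχ1, hχ2⟩ := exists_character_apply_ne_neg_one h1 h2 ht
  obtain ⟨φ1, h12, h11, h1m⟩ := exists_character_avoiding h1 hχ1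
  obtain ⟨φ2, h21, h22, h2m⟩ := exists_character_avoiding (c := (χ σ2)⁻¹) h2
    (by simpa using hχ2)
  exact ⟨φ1, φ2, χ, hχ, ⟨h11, h22, h12, h21⟩, h1m, h2m⟩
end

section
/- Let G be a finite abelian group and let σ1, σ2, τ ∈ G be nontrivial elements such that the order of τ is strictly greater than 2, τ lies in the subgroup ⟨σ1, σ2⟩ generated by σ1 and σ2, and ⟨σ1, σ2⟩ is cyclic. Then there exist characters φ, χ of G such that: (i) χ(τ) ≠ 1; (ii) φ(σ1) ≠ 1 and φ(σ2) ≠ 1; (iii) φ(σ1)·χ(σ1) ≠ 1 and φ(σ2)·χ(σ2) ≠ 1. -/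
/-- For a cyclic subgroup of a finite commutative group, some complex character of the whole
group restricts to a faithful character of the subgroup. -/
theorem exists_monoidHom_injOn_of_isCyclic {G : Type*} [CommGroup G] [Finite G]
    (H : Subgroup G) [IsCyclic H] :
    ∃ φ : G →* ℂˣ, ∀ x ∈ H, φ x = 1 → x = 1 := by
  have : NeZero (Nat.card H) := ⟨Nat.card_pos.ne'⟩
  have hcard : Nat.card H = Nat.card (rootsOfUnity (Nat.card H) ℂ) :=
    (Complex.card_rootsOfUnity _).symm
  let e : H ≃* rootsOfUnity (Nat.card H) ℂ := mulEquivOfCyclicCardEq hcard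
  obtain ⟨φ, hφ⟩ := MonoidHom.domRestrict_surjective ℂ H
    ((rootsOfUnity (Nat.card H) ℂ).subtype.comp e.toMonoidHom)
  refine ⟨φ, fun x hx h ↦ ?_⟩
  have hx' := DFunLike.congr_fun hφ ⟨x, hx⟩
  have he : e ⟨x, hx⟩ = 1 := Subtype.ext (hx'.symm.trans h)
  simpa using he

/-- Lemma 4.13(2). Let `G` be a finite abelian group, `σ1, σ2, τ` nontrivial
elements of `G` with `orderOf τ > 2`, `τ ∈ ⟨σ1, σ2⟩` and `⟨σ1, σ2⟩` cyclic (rank 1).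
Then there are characters `φ, χ : G → ℂ*` with (i) `χ(τ) ≠ 1`; (ii) `φ(σi) ≠ 1` for each `i`;
(iii) `φ(σi)·χ(σi) ≠ 1` for each `i`. -/
theorem stmt2 {G : Type*} [CommGroup G] [Finite G]
    (σ1 σ2 τ : G) (hσ1 : σ1 ≠ 1) (hσ2 : σ2 ≠ 1) (hτne : τ ≠ 1)
    (hord : 2 < orderOf τ)
    (hmem : τ ∈ Subgroup.closure {σ1, σ2})
    (hrank : IsCyclic (Subgroup.closure {σ1, σ2} : Subgroup G)) :
    ∃ φ χ : G →* ℂˣ,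
      χ τ ≠ 1 ∧
      (φ σ1 ≠ 1 ∧ φ σ2 ≠ 1) ∧
      (φ σ1 * χ σ1 ≠ 1 ∧ φ σ2 * χ σ2 ≠ 1) := by
  obtain ⟨φ, hφ⟩ := exists_monoidHom_injOn_of_isCyclic (Subgroup.closure {σ1, σ2})
  have h1 : φ σ1 ≠ 1 := fun h ↦ hσ1 (hφ _ (Subgroup.subset_closure (by simp)) h)
  have h2 : φ σ2 ≠ 1 := fun h ↦ hσ2 (hφ _ (Subgroup.subset_closure (by simp)) h)
  refine ⟨φ, (φ ^ 2)⁻¹, fun h ↦ ?_, ⟨h1, h2⟩, ?_, ?_⟩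
  · have hτ : φ (τ ^ 2) = 1 := by simpa using h
    exact hord.not_ge (orderOf_le_of_pow_eq_one two_pos (hφ _ (pow_mem hmem 2) hτ))
  · simpa [pow_two] using h1
  · simpa [pow_two] using h2
end

section
/- Let n1, n2, n3 be positive integers, let G = ℤ/2n1 × ℤ/2n2 × ℤ/2n3 with standard generators e1 = (1,0,0), e2 = (0,1,0), e3 = (0,0,1), let Ki = ⟨ei⟩ for i = 1,2,3, and let φi be the character of G with φi(x1,x2,x3) = exp(2π√(-1)·xi/(2ni)). Let S = {(τ1,τ2,τ3) ∈ G×G×G : for all odd integers k1, k2, k3, φ2(τ1)^{k2}·φ3(τ1)^{k3}·φ1(τ2)^{k1}·φ3(τ2)^{-k3}·φ1(τ3)^{-k1}·φ2(τ3)^{-k2} = 1}. Then S is the subgroup of G×G×G generated by KΔ_G together with the elements (n2·e2, n1·e1, 0) and (n2·e2, n3·e3, 0), and the quotient group S/KΔ_G is isomorphic to ℤ/2 × ℤ/2. -/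
namespace Stmt4

/-- The group `G = ℤ/2n1 × ℤ/2n2 × ℤ/2n3`. -/
abbrev G (n1 n2 n3 : ℕ) := ZMod (2*n1) × ZMod (2*n2) × ZMod (2*n3)

/-- The character value `exp(2π√(-1)·x/m)` on `ℤ/m`. -/
noncomputable def phi (m : ℕ) (x : ZMod m) : ℂ :=
  Complex.exp (2 * (Real.pi : ℂ) * Complex.I * (x.val : ℂ) / (m : ℂ))

def e1 (n1 n2 n3 : ℕ) : G n1 n2 n3 := (1, 0, 0)
def e2 (n1 n2 n3 : ℕ) : G n1 n2 n3 := (0, 1, 0)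
def e3 (n1 n2 n3 : ℕ) : G n1 n2 n3 := (0, 0, 1)

/-- `KΔ_G`: the subgroup of `G×G×G` generated by `K1×K2×K3` (with `Ki = ⟨ei⟩`) and the
diagonal `Δ_G`. -/
def KDelta (n1 n2 n3 : ℕ) : AddSubgroup (G n1 n2 n3 × G n1 n2 n3 × G n1 n2 n3) :=
  AddSubgroup.closure
    ({x | x.1 ∈ AddSubgroup.closure {e1 n1 n2 n3} ∧
          x.2.1 ∈ AddSubgroup.closure {e2 n1 n2 n3} ∧
          x.2.2 ∈ AddSubgroup.closure {e3 n1 n2 n3}} ∪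
     {x | ∃ g : G n1 n2 n3, x = (g, g, g)})

/-- The set `S` of triples `(τ1,τ2,τ3)` annihilated by all admissible characters
`φ2^{k2}φ3^{k3} ⊗ φ1^{k1}φ3^{-k3} ⊗ φ1^{-k1}φ2^{-k2}` with `k1, k2, k3` odd. -/
noncomputable def S (n1 n2 n3 : ℕ) : Set (G n1 n2 n3 × G n1 n2 n3 × G n1 n2 n3) :=
  {τ | ∀ k1 k2 k3 : ℤ, Odd k1 → Odd k2 → Odd k3 →
    phi (2*n2) τ.1.2.1 ^ k2 * phi (2*n3) τ.1.2.2 ^ k3 *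
    phi (2*n1) τ.2.1.1 ^ k1 * phi (2*n3) τ.2.1.2.2 ^ (-k3) *
    phi (2*n1) τ.2.2.1 ^ (-k1) * phi (2*n2) τ.2.2.2.1 ^ (-k2) = 1}

/-- The subgroup generated by `KΔ_G` together with `(n2·e2, n1·e1, 0)` and `(n2·e2, n3·e3, 0)`. -/
def SGrp (n1 n2 n3 : ℕ) : AddSubgroup (G n1 n2 n3 × G n1 n2 n3 × G n1 n2 n3) :=
  KDelta n1 n2 n3 ⊔ AddSubgroup.closure
    {(n2 • e2 n1 n2 n3, n1 • e1 n1 n2 n3, (0 : G n1 n2 n3)),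
     (n2 • e2 n1 n2 n3, n3 • e3 n1 n2 n3, (0 : G n1 n2 n3))}

lemma natCast_add_self (n : ℕ) : (n + n : ZMod (2 * n)) = 0 := by
  rw [← two_mul]
  exact_mod_cast ZMod.natCast_self (2 * n)

/-- The inclusion of `ℤ/2` into `ℤ/2n` that sends `1` to `n`. -/
def half (n : ℕ) : ZMod 2 →+ ZMod (2 * n) :=
  ZMod.lift 2 ⟨zmultiplesHom _ (n : ZMod (2 * n)), by
    simp [two_mul, natCast_add_self]⟩

@[simp]
lemma half_one (n : ℕ) : half n 1 = n := by
  rw [half, ← Int.cast_one, ZMod.lift_coe]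
  simp

lemma zmod_two_eq_zero_or_one : ∀ x : ZMod 2, x = 0 ∨ x = 1 := by
  decide

lemma natCast_ne_zero {n : ℕ} (hn : 0 < n) : (n : ZMod (2 * n)) ≠ 0 := by
  rw [Ne, ZMod.natCast_eq_zero_iff]
  intro h
  have := Nat.le_of_dvd hn h
  omega

lemma half_injective {n : ℕ} (hn : 0 < n) : Function.Injective (half n) := by
  rw [injective_iff_map_eq_zero]
  intro a ha
  obtain rfl | rfl := zmod_two_eq_zero_or_one a
  · rfl
  · rw [half_one] at ha
    exact (natCast_ne_zero hn ha).elim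

lemma neg_natCast_self (n : ℕ) : -(n : ZMod (2 * n)) = n := by
  rw [neg_eq_iff_add_eq_zero, natCast_add_self]

lemma eq_zero_or_eq_natCast {n : ℕ} (hn : 0 < n) {a : ZMod (2 * n)} (ha : a + a = 0) :
    a = 0 ∨ a = n := by
  have : NeZero (2 * n) := ⟨by omega⟩
  have hlt := ZMod.val_lt a
  have hdvd : 2 * n ∣ a.val + a.val := by
    rw [← ZMod.natCast_eq_zero_iff]
    simpa using ha
  obtain ⟨c, hc⟩ := hdvd
  have hval : a.val = n * c := by linarith
  have hc2 : c < 2 := by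
    by_contra! h
    nlinarith
  rw [← ZMod.natCast_zmod_val a, hval]
  interval_cases c <;> simp

lemma phi_eq_stdAddChar (m : ℕ) [NeZero m] (x : ZMod m) : phi m x = ZMod.stdAddChar x := by
  rw [phi, ZMod.stdAddChar_apply, ZMod.toCircle_apply]

lemma stdAddChar_natCast {n : ℕ} (hn : 0 < n) [NeZero (2 * n)] :
    ZMod.stdAddChar (n : ZMod (2 * n)) = -1 := by
  have hsq : ZMod.stdAddChar (n : ZMod (2 * n)) * ZMod.stdAddChar (n : ZMod (2 * n)) = 1 := by
    rw [← AddChar.map_add_eq_mul, natCast_add_self, AddChar.map_zero_eq_one]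
  refine (mul_self_eq_one_iff.mp hsq).resolve_left fun h ↦ natCast_ne_zero hn ?_
  exact ZMod.injective_stdAddChar (h.trans (AddChar.map_zero_eq_one _).symm)

/-- The three coordinate differences of a triple seen by the characters defining `S`. -/
def diff (n1 n2 n3 : ℕ) : G n1 n2 n3 × G n1 n2 n3 × G n1 n2 n3 →+ G n1 n2 n3 where
  toFun τ := (τ.2.1.1 - τ.2.2.1, τ.1.2.1 - τ.2.2.2.1, τ.1.2.2 - τ.2.1.2.2)
  map_zero' := by simp
  map_add' x y := by ext <;> simp <;> abel

lemma diff_apply {n1 n2 n3 : ℕ} (τ : G n1 n2 n3 × G n1 n2 n3 × G n1 n2 n3) :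
    diff n1 n2 n3 τ = (τ.2.1.1 - τ.2.2.1, τ.1.2.1 - τ.2.2.2.1, τ.1.2.2 - τ.2.1.2.2) :=
  rfl

lemma mem_closure_e1 {n1 n2 n3 : ℕ} {g : G n1 n2 n3} :
    g ∈ AddSubgroup.closure {e1 n1 n2 n3} ↔ g.2.1 = 0 ∧ g.2.2 = 0 := by
  rw [AddSubgroup.mem_closure_singleton]
  constructor
  · rintro ⟨k, rfl⟩
    simp [e1]
  · rintro ⟨h, h'⟩
    obtain ⟨k, hk⟩ := ZMod.intCast_surjective g.1
    exact ⟨k, by ext <;> simp [e1, h, h', hk]⟩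

lemma mem_closure_e2 {n1 n2 n3 : ℕ} {g : G n1 n2 n3} :
    g ∈ AddSubgroup.closure {e2 n1 n2 n3} ↔ g.1 = 0 ∧ g.2.2 = 0 := by
  rw [AddSubgroup.mem_closure_singleton]
  constructor
  · rintro ⟨k, rfl⟩
    simp [e2]
  · rintro ⟨h, h'⟩
    obtain ⟨k, hk⟩ := ZMod.intCast_surjective g.2.1
    exact ⟨k, by ext <;> simp [e2, h, h', hk]⟩

lemma mem_closure_e3 {n1 n2 n3 : ℕ} {g : G n1 n2 n3} :
    g ∈ AddSubgroup.closure {e3 n1 n2 n3} ↔ g.1 = 0 ∧ g.2.1 = 0 := by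
  rw [AddSubgroup.mem_closure_singleton]
  constructor
  · rintro ⟨k, rfl⟩
    simp [e3]
  · rintro ⟨h, h'⟩
    obtain ⟨k, hk⟩ := ZMod.intCast_surjective g.2.2
    exact ⟨k, by ext <;> simp [e3, h, h', hk]⟩

lemma KDelta_eq_ker (n1 n2 n3 : ℕ) : KDelta n1 n2 n3 = (diff n1 n2 n3).ker := by
  apply le_antisymm
  · rw [KDelta, AddSubgroup.closure_le]
    rintro τ (⟨h, h', h''⟩ | ⟨g, rfl⟩)
    · rw [mem_closure_e1] at h
      rw [mem_closure_e2] at h'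
      rw [mem_closure_e3] at h''
      simp [AddMonoidHom.mem_ker, diff_apply, h, h', h'']
    · simp [AddMonoidHom.mem_ker, diff_apply]
  · intro τ hτ
    simp only [AddMonoidHom.mem_ker, diff_apply, Prod.mk_eq_zero, sub_eq_zero] at hτ
    obtain ⟨ha, hb, hc⟩ := hτ
    let g : G n1 n2 n3 := (τ.2.1.1, τ.1.2.1, τ.1.2.2)
    rw [← sub_add_cancel τ (g, g, g)]
    refine add_mem (AddSubgroup.subset_closure (Or.inl ⟨?_, ?_, ?_⟩))
      (AddSubgroup.subset_closure (Or.inr ⟨g, rfl⟩))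
    · simp [mem_closure_e1, g]
    · simp [mem_closure_e2, g, hc]
    · simp [mem_closure_e3, g, ha, hb]

/-- The embedding of `ℤ/2 × ℤ/2` into `G` whose image is `diff S`. -/
def klein (n1 n2 n3 : ℕ) : ZMod 2 × ZMod 2 →+ G n1 n2 n3 where
  toFun x := (half n1 x.1, half n2 (x.1 + x.2), half n3 x.2)
  map_zero' := by simp
  map_add' x y := by
    ext
    · simp
    · simp [add_add_add_comm]
    · simp

lemma klein_apply {n1 n2 n3 : ℕ} (x : ZMod 2 × ZMod 2) :
    klein n1 n2 n3 x = (half n1 x.1, half n2 (x.1 + x.2), half n3 x.2) :=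
  rfl

lemma klein_injective {n1 n2 n3 : ℕ} (h1 : 0 < n1) (h3 : 0 < n3) :
    Function.Injective (klein n1 n2 n3) := by
  intro x y h
  simp only [klein_apply, Prod.mk.injEq] at h
  exact Prod.ext (half_injective h1 h.1) (half_injective h3 h.2.2)

lemma diff_fst_generator (n1 n2 n3 : ℕ) :
    diff n1 n2 n3 (n2 • e2 n1 n2 n3, n1 • e1 n1 n2 n3, 0) = klein n1 n2 n3 (1, 0) := by
  simp [diff_apply, klein_apply, e1, e2]

lemma diff_snd_generator (n1 n2 n3 : ℕ) :
    diff n1 n2 n3 (n2 • e2 n1 n2 n3, n3 • e3 n1 n2 n3, 0) = klein n1 n2 n3 (0, 1) := by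
  simp [diff_apply, klein_apply, e2, e3, neg_natCast_self]

lemma SGrp_eq_comap (n1 n2 n3 : ℕ) :
    SGrp n1 n2 n3 = (klein n1 n2 n3).range.comap (diff n1 n2 n3) := by
  have hmap : (klein n1 n2 n3).range = (AddSubgroup.closure
      {(n2 • e2 n1 n2 n3, n1 • e1 n1 n2 n3, (0 : G n1 n2 n3)),
        (n2 • e2 n1 n2 n3, n3 • e3 n1 n2 n3, (0 : G n1 n2 n3))}).map (diff n1 n2 n3) := by
    have htop : AddSubgroup.closure {((1, 0) : ZMod 2 × ZMod 2), (0, 1)} = ⊤ := by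
      rw [eq_top_iff]
      rintro x -
      rw [AddSubgroup.mem_closure_pair]
      exact ⟨x.1.val, x.2.val, by ext <;> simp⟩
    rw [AddMonoidHom.map_closure, Set.image_pair, diff_fst_generator, diff_snd_generator,
      ← Set.image_pair, ← AddMonoidHom.map_closure, htop, AddMonoidHom.range_eq_map]
  rw [hmap, AddSubgroup.comap_map_eq, SGrp, KDelta_eq_ker, sup_comm]

lemma forall_odd_zpow_mul_eq_one_iff {u v w : ℂ} (hu : u ≠ 0) (hv : v ≠ 0) (hw : w ≠ 0) :
    (∀ k1 k2 k3 : ℤ, Odd k1 → Odd k2 → Odd k3 → u ^ k1 * v ^ k2 * w ^ k3 = 1) ↔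
      u * u = 1 ∧ w * w = 1 ∧ v = u * w := by
  constructor
  · intro h
    have h₀ := h 1 1 1 odd_one odd_one odd_one
    have h₁ := h (-1) 1 1 odd_neg_one odd_one odd_one
    have h₃ := h 1 1 (-1) odd_one odd_one odd_neg_one
    simp only [zpow_one, zpow_neg] at h₀ h₁ h₃
    field_simp at h₁ h₃
    have hu2 : u * u = 1 := by linear_combination h₀ - u * h₁
    have hw2 : w * w = 1 := by linear_combination h₀ - w * h₃
    exact ⟨hu2, hw2, by linear_combination u * w * h₀ - v * w * w * hu2 - v * hw2⟩
  · rintro ⟨hu2, hw2, rfl⟩ k1 k2 k3 o1 o2 o3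
    obtain rfl | rfl := mul_self_eq_one_iff.mp hu2 <;>
      obtain rfl | rfl := mul_self_eq_one_iff.mp hw2 <;>
      simp [o1.neg_one_zpow, o2.neg_one_zpow, o3.neg_one_zpow]

lemma mem_S_iff {n1 n2 n3 : ℕ} (h1 : 0 < n1) (h2 : 0 < n2) (h3 : 0 < n3)
    (τ : G n1 n2 n3 × G n1 n2 n3 × G n1 n2 n3) :
    τ ∈ S n1 n2 n3 ↔ diff n1 n2 n3 τ ∈ (klein n1 n2 n3).range := by
  have : NeZero (2 * n1) := ⟨by omega⟩
  have : NeZero (2 * n2) := ⟨by omega⟩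
  have : NeZero (2 * n3) := ⟨by omega⟩
  obtain ⟨⟨x1, x2, x3⟩, ⟨y1, y2, y3⟩, ⟨z1, z2, z3⟩⟩ := τ
  have hprod (k1 k2 k3 : ℤ) :
      phi (2*n2) x2 ^ k2 * phi (2*n3) x3 ^ k3 * phi (2*n1) y1 ^ k1 * phi (2*n3) y3 ^ (-k3) *
        phi (2*n1) z1 ^ (-k1) * phi (2*n2) z2 ^ (-k2) =
      ZMod.stdAddChar (y1 - z1) ^ k1 * ZMod.stdAddChar (x2 - z2) ^ k2 *
        ZMod.stdAddChar (x3 - y3) ^ k3 := by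
    simp only [phi_eq_stdAddChar, AddChar.map_sub_eq_div, div_zpow, zpow_neg]
    ring
  have hne {m : ℕ} [NeZero m] (a : ZMod m) : ZMod.stdAddChar a ≠ 0 := by
    rw [ZMod.stdAddChar_apply]
    exact Circle.coe_ne_zero _
  simp only [S, Set.mem_ofPred_eq, hprod, diff_apply]
  rw [forall_odd_zpow_mul_eq_one_iff (hne _) (hne _) (hne _)]
  generalize y1 - z1 = a, x2 - z2 = b, x3 - y3 = c
  have hself {m : ℕ} [NeZero m] {d : ZMod m}
      (h : ZMod.stdAddChar d * ZMod.stdAddChar d = 1) : d + d = 0 := by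
    rw [← AddChar.map_add_eq_mul] at h
    exact ZMod.injective_stdAddChar (h.trans (AddChar.map_zero_eq_one _).symm)
  have hchar {n : ℕ} (hn : 0 < n) [NeZero (2 * n)] (x : ZMod 2) :
      ZMod.stdAddChar (half n x) = (-1) ^ x.val := by
    obtain rfl | rfl := zmod_two_eq_zero_or_one x
    · simp
    · simp [stdAddChar_natCast hn, ZMod.val_one]
  have hsign (x y : ZMod 2) : (-1 : ℂ) ^ (x + y).val = (-1) ^ x.val * (-1) ^ y.val := by
    rw [← pow_add, ZMod.val_add, ← neg_one_pow_eq_pow_mod_two]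
  have hhalf {n : ℕ} (hn : 0 < n) {d : ZMod (2 * n)} (h : d + d = 0) : ∃ x, half n x = d := by
    obtain rfl | rfl := eq_zero_or_eq_natCast hn h
    · exact ⟨0, map_zero _⟩
    · exact ⟨1, half_one n⟩
  constructor
  · rintro ⟨ha, hc, hb⟩
    obtain ⟨x, rfl⟩ := hhalf h1 (hself ha)
    obtain ⟨y, rfl⟩ := hhalf h3 (hself hc)
    refine ⟨(x, y), ?_⟩
    rw [hchar h1, hchar h3, ← hsign, ← hchar h2] at hb
    rw [klein_apply, ZMod.injective_stdAddChar hb]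
  · rintro ⟨⟨x, y⟩, hxy⟩
    simp only [klein_apply, Prod.mk.injEq] at hxy
    obtain ⟨rfl, rfl, rfl⟩ := hxy
    rw [hchar h1, hchar h2, hchar h3]
    exact ⟨by simp [← mul_pow], by simp [← mul_pow], hsign x y⟩

/-- Example 1, `Aut_0(X) ≅ ℤ/2 ⊕ ℤ/2`. `S` is the subgroup of `G×G×G`
generated by `KΔ_G` together with `(n2·e2, n1·e1, 0)` and `(n2·e2, n3·e3, 0)`, and
`S/KΔ_G ≅ ℤ/2 × ℤ/2`. -/
theorem stmt4 (n1 n2 n3 : ℕ) (h1 : 0 < n1) (h2 : 0 < n2) (h3 : 0 < n3) :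
    S n1 n2 n3 = (SGrp n1 n2 n3 : Set (G n1 n2 n3 × G n1 n2 n3 × G n1 n2 n3)) ∧
    Nonempty
      ((SGrp n1 n2 n3 ⧸ ((KDelta n1 n2 n3).addSubgroupOf (SGrp n1 n2 n3)))
        ≃+ (ZMod 2 × ZMod 2)) := by
  refine ⟨?_, ?_⟩
  · ext τ
    rw [mem_S_iff h1 h2 h3, SGrp_eq_comap]
    rfl
  · let f := (diff n1 n2 n3).comp (SGrp n1 n2 n3).subtype
    have hker : (KDelta n1 n2 n3).addSubgroupOf (SGrp n1 n2 n3) = f.ker := by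
      rw [KDelta_eq_ker]
      rfl
    have hrange : f.range = (klein n1 n2 n3).range := by
      rw [AddMonoidHom.range_comp, AddSubgroup.range_subtype, SGrp_eq_comap,
        AddSubgroup.map_comap_eq, inf_eq_right]
      rintro ⟨a, b, c⟩ -
      exact ⟨((0, b, c), (a, 0, 0), 0), by simp [diff_apply]⟩
    exact ⟨(QuotientAddGroup.quotientAddEquivOfEq hker).trans <|
      (QuotientAddGroup.quotientKerEquivRange f).trans <|
      (AddEquiv.addSubgroupCongr hrange).trans
        (AddMonoidHom.ofInjective (klein_injective h1 h3)).symm⟩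

end Stmt4
end

section
/- Let n1, n2, n3 be positive integers, let G = ℤ/2n1 × ℤ/2n2 × ℤ/2n3 with standard generators e1 = (1,0,0), e2 = (0,1,0), e3 = (0,0,1), let Ki = ⟨ei⟩ for i = 1,2,3, and let φi be the character of G with φi(x1,x2,x3) = exp(2π√(-1)·xi/(2ni)). Let S = {(τ1,τ2,τ3) ∈ G×G×G : for all integers k1, k2, k3 with k1 odd and k2 even, φ2(τ1)^{k2}·φ3(τ1)^{k3}·φ1(τ2)^{k1}·φ3(τ2)^{-k3}·φ1(τ3)^{-k1}·φ2(τ3)^{-k2} = 1}. Then S is the subgroup of G×G×G generated by KΔ_G together with the element (n2·e2, 0, 0), and the quotient group S/KΔ_G is cyclic of order 2. -/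
namespace Stmt5

/-- The group `G = ℤ/2n1 × ℤ/2n2 × ℤ/2n3`. -/
abbrev G (n1 n2 n3 : ℕ) := ZMod (2*n1) × ZMod (2*n2) × ZMod (2*n3)

/-- The character value `exp(2π√(-1)·x/m)` on `ℤ/m`. -/
noncomputable def phi (m : ℕ) (x : ZMod m) : ℂ :=
  Complex.exp (2 * (Real.pi : ℂ) * Complex.I * (x.val : ℂ) / (m : ℂ))

def e1 (n1 n2 n3 : ℕ) : G n1 n2 n3 := (1, 0, 0)
def e2 (n1 n2 n3 : ℕ) : G n1 n2 n3 := (0, 1, 0)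
def e3 (n1 n2 n3 : ℕ) : G n1 n2 n3 := (0, 0, 1)

/-- `KΔ_G`: the subgroup of `G×G×G` generated by `K1×K2×K3` (with `Ki = ⟨ei⟩`) and the
diagonal `Δ_G`. -/
def KDelta (n1 n2 n3 : ℕ) : AddSubgroup (G n1 n2 n3 × G n1 n2 n3 × G n1 n2 n3) :=
  AddSubgroup.closure
    ({x | x.1 ∈ AddSubgroup.closure {e1 n1 n2 n3} ∧
          x.2.1 ∈ AddSubgroup.closure {e2 n1 n2 n3} ∧
          x.2.2 ∈ AddSubgroup.closure {e3 n1 n2 n3}} ∪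
     {x | ∃ g : G n1 n2 n3, x = (g, g, g)})

/-- The set `S` of triples `(τ1,τ2,τ3)` annihilated by all admissible characters
`φ2^{k2}φ3^{k3} ⊗ φ1^{k1}φ3^{-k3} ⊗ φ1^{-k1}φ2^{-k2}` with `k1` odd and `k2` even. -/
noncomputable def S (n1 n2 n3 : ℕ) : Set (G n1 n2 n3 × G n1 n2 n3 × G n1 n2 n3) :=
  {τ | ∀ k1 k2 k3 : ℤ, Odd k1 → Even k2 →
    phi (2*n2) τ.1.2.1 ^ k2 * phi (2*n3) τ.1.2.2 ^ k3 *
    phi (2*n1) τ.2.1.1 ^ k1 * phi (2*n3) τ.2.1.2.2 ^ (-k3) *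
    phi (2*n1) τ.2.2.1 ^ (-k1) * phi (2*n2) τ.2.2.2.1 ^ (-k2) = 1}

/-- The subgroup generated by `KΔ_G` together with `(n2·e2, 0, 0)`. -/
def SGrp (n1 n2 n3 : ℕ) : AddSubgroup (G n1 n2 n3 × G n1 n2 n3 × G n1 n2 n3) :=
  KDelta n1 n2 n3 ⊔ AddSubgroup.closure
    {(n2 • e2 n1 n2 n3, (0 : G n1 n2 n3), (0 : G n1 n2 n3))}

theorem phi_eq_stdAddChar (m : ℕ) [NeZero m] (x : ZMod m) : phi m x = ZMod.stdAddChar x := by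
  rw [ZMod.stdAddChar_apply, ZMod.toCircle_apply, phi]

theorem phi_ne_zero (m : ℕ) (x : ZMod m) : phi m x ≠ 0 :=
  Complex.exp_ne_zero _

theorem phi_injective (m : ℕ) [NeZero m] : Function.Injective (phi m) := by
  intro x y h
  rw [phi_eq_stdAddChar, phi_eq_stdAddChar] at h
  exact ZMod.injective_stdAddChar h

theorem phi_sq (m : ℕ) [NeZero m] (x : ZMod m) : phi m x ^ 2 = phi m (2 * x) := by
  rw [phi_eq_stdAddChar, phi_eq_stdAddChar, two_mul, AddChar.map_add_eq_mul, sq]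

theorem two_mul_natCast_half (n : ℕ) : (2 : ZMod (2 * n)) * (n : ZMod (2 * n)) = 0 := by
  exact_mod_cast ZMod.natCast_self (2 * n)

theorem natCast_half_ne_zero {n : ℕ} (hn : 0 < n) : (n : ZMod (2 * n)) ≠ 0 := by
  rw [Ne, ZMod.natCast_eq_zero_iff]
  intro h
  have := Nat.le_of_dvd hn h
  omega

theorem two_mul_eq_zero_iff {n : ℕ} (hn : 0 < n) (a : ZMod (2 * n)) :
    2 * a = 0 ↔ a = 0 ∨ a = n := by
  constructor
  · intro h
    have : NeZero (2 * n) := ⟨by omega⟩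
    have hlt := ZMod.val_lt a
    have ha : ((a.val : ℕ) : ZMod (2 * n)) = a := ZMod.natCast_zmod_val a
    have hd : 2 * n ∣ 2 * a.val := by
      rw [← ZMod.natCast_eq_zero_iff]
      push_cast
      rw [ha, h]
    obtain ⟨c, hc⟩ := Nat.dvd_of_mul_dvd_mul_left two_pos hd
    have hc2 : c < 2 := by
      by_contra! h2
      nlinarith
    interval_cases c
    · left
      rw [← ha, hc]
      simp
    · right
      rw [← ha, hc]
      simp
  · rintro (rfl | rfl)
    · simp
    · exact two_mul_natCast_half n

theorem mem_S_iff {n1 n2 n3 : ℕ} (h1 : 0 < n1) (h2 : 0 < n2) (h3 : 0 < n3)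
    (τ : G n1 n2 n3 × G n1 n2 n3 × G n1 n2 n3) :
    τ ∈ S n1 n2 n3 ↔ τ.2.1.1 = τ.2.2.1 ∧ τ.1.2.2 = τ.2.1.2.2 ∧
      2 * (τ.1.2.1 - τ.2.2.2.1) = 0 := by
  have : NeZero (2 * n1) := ⟨by omega⟩
  have : NeZero (2 * n2) := ⟨by omega⟩
  have : NeZero (2 * n3) := ⟨by omega⟩
  rw [mul_sub, sub_eq_zero]
  have hinv {m : ℕ} {x y : ZMod m} (h : phi m x * (phi m y)⁻¹ = 1) : phi m x = phi m y :=
    (mul_inv_eq_one₀ (phi_ne_zero m y)).1 h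
  constructor
  · intro h
    have hc : τ.2.1.1 = τ.2.2.1 := phi_injective _ <| hinv <| by
      simpa using h 1 0 0 odd_one Even.zero
    refine ⟨hc, phi_injective _ <| hinv ?_, phi_injective _ ?_⟩
    · have := h 1 0 1 odd_one Even.zero
      rw [hc, zpow_one, zpow_one, zpow_neg_one, zpow_neg_one,
        mul_right_comm (phi _ _ ^ _ * _)] at this
      simpa [phi_ne_zero] using this
    · rw [← phi_sq, ← phi_sq, ← mul_inv_eq_one₀ (pow_ne_zero 2 (phi_ne_zero _ _))]
      have := h 1 2 0 odd_one even_two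
      simp only [hc, zpow_zero, zpow_one, zpow_neg, neg_zero, mul_one] at this
      rw [mul_assoc (_ ^ (2 : ℤ)), mul_inv_cancel₀ (phi_ne_zero _ _), mul_one] at this
      exact_mod_cast this
  · rintro ⟨hc, hb, ha⟩ k1 k2 k3 - ⟨r, rfl⟩
    have hpow : phi (2 * n2) τ.1.2.1 ^ (r + r) = phi (2 * n2) τ.2.2.2.1 ^ (r + r) := by
      rw [← two_mul, zpow_mul, zpow_mul]
      have := congrArg (phi (2 * n2)) ha
      rw [← phi_sq, ← phi_sq] at this
      norm_cast
      rw [this]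
    rw [hc, hb, hpow, zpow_neg, zpow_neg, zpow_neg]
    have hx := zpow_ne_zero k1 (phi_ne_zero (2 * n1) τ.2.2.1)
    have hy := zpow_ne_zero (r + r) (phi_ne_zero (2 * n2) τ.2.2.2.1)
    have hz := zpow_ne_zero k3 (phi_ne_zero (2 * n3) τ.2.1.2.2)
    generalize phi (2 * n1) τ.2.2.1 ^ k1 = x at *
    generalize phi (2 * n2) τ.2.2.2.1 ^ (r + r) = y at *
    generalize phi (2 * n3) τ.2.1.2.2 ^ k3 = z at *
    field_simp

/-- The subgroup of triples satisfying the coordinate equations that cut out `KΔ_G`. -/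
def coordSubgroup (n1 n2 n3 : ℕ) : AddSubgroup (G n1 n2 n3 × G n1 n2 n3 × G n1 n2 n3) where
  carrier := {τ | τ.2.1.1 = τ.2.2.1 ∧ τ.1.2.2 = τ.2.1.2.2 ∧ τ.1.2.1 = τ.2.2.2.1}
  zero_mem' := by simp
  add_mem' := by
    rintro a b ⟨h1, h2, h3⟩ ⟨h4, h5, h6⟩
    simp [h1, h2, h3, h4, h5, h6]
  neg_mem' := by
    rintro a ⟨h1, h2, h3⟩
    simp [h1, h2, h3]

theorem KDelta_eq_coordSubgroup (n1 n2 n3 : ℕ) :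
    KDelta n1 n2 n3 = coordSubgroup n1 n2 n3 := by
  apply le_antisymm
  · rw [KDelta, AddSubgroup.closure_le]
    rintro ⟨x, y, z⟩ (⟨hx, hy, hz⟩ | ⟨g, hg⟩)
    · simp only [AddSubgroup.mem_closure_singleton] at hx hy hz
      obtain ⟨a, rfl⟩ := hx
      obtain ⟨b, rfl⟩ := hy
      obtain ⟨c, rfl⟩ := hz
      simp [coordSubgroup, e1, e2, e3]
    · simp only [Prod.mk.injEq] at hg
      obtain ⟨rfl, rfl, rfl⟩ := hg
      exact ⟨rfl, rfl, rfl⟩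
  · rintro ⟨⟨x1, x2, x3⟩, ⟨y1, y2, y3⟩, ⟨z1, z2, z3⟩⟩ ⟨h1, h2, h3⟩
    dsimp only at h1 h2 h3
    subst h1 h2 h3
    obtain ⟨a, ha⟩ := ZMod.intCast_surjective (x1 - y1)
    obtain ⟨b, hb⟩ := ZMod.intCast_surjective (y2 - x2)
    obtain ⟨c, hc⟩ := ZMod.intCast_surjective (z3 - x3)
    have hk : (((x1 - y1, 0, 0), (0, y2 - x2, 0), (0, 0, z3 - x3)) :
        G n1 n2 n3 × G n1 n2 n3 × G n1 n2 n3) ∈ KDelta n1 n2 n3 := by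
      refine AddSubgroup.subset_closure (Or.inl ⟨?_, ?_, ?_⟩)
      · exact AddSubgroup.mem_closure_singleton.2 ⟨a, by simp [e1, ha]⟩
      · exact AddSubgroup.mem_closure_singleton.2 ⟨b, by simp [e2, hb]⟩
      · exact AddSubgroup.mem_closure_singleton.2 ⟨c, by simp [e3, hc]⟩
    have hd : (((y1, x2, x3), (y1, x2, x3), (y1, x2, x3)) :
        G n1 n2 n3 × G n1 n2 n3 × G n1 n2 n3) ∈ KDelta n1 n2 n3 :=
      AddSubgroup.subset_closure (Or.inr ⟨_, rfl⟩)
    simpa using add_mem hk hd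

theorem mem_KDelta_iff {n1 n2 n3 : ℕ} (τ : G n1 n2 n3 × G n1 n2 n3 × G n1 n2 n3) :
    τ ∈ KDelta n1 n2 n3 ↔
      τ.2.1.1 = τ.2.2.1 ∧ τ.1.2.2 = τ.2.1.2.2 ∧ τ.1.2.1 = τ.2.2.2.1 := by
  rw [KDelta_eq_coordSubgroup]
  rfl

theorem halfElement_mem_SGrp (n1 n2 n3 : ℕ) :
    (n2 • e2 n1 n2 n3, (0 : G n1 n2 n3), (0 : G n1 n2 n3)) ∈ SGrp n1 n2 n3 :=
  AddSubgroup.mem_sup_right (AddSubgroup.mem_closure_singleton_self _)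

theorem mem_SGrp_iff {n1 n2 n3 : ℕ} (h2 : 0 < n2)
    (τ : G n1 n2 n3 × G n1 n2 n3 × G n1 n2 n3) :
    τ ∈ SGrp n1 n2 n3 ↔ τ.2.1.1 = τ.2.2.1 ∧ τ.1.2.2 = τ.2.1.2.2 ∧
      2 * (τ.1.2.1 - τ.2.2.2.1) = 0 := by
  constructor
  · intro h
    obtain ⟨y, hy, z, hz, rfl⟩ := AddSubgroup.mem_sup.1 h
    obtain ⟨k, rfl⟩ := AddSubgroup.mem_closure_singleton.1 hz
    obtain ⟨hc, hb, ha⟩ := (mem_KDelta_iff y).1 hy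
    simp [e2, hc, hb, ha, mul_left_comm, two_mul_natCast_half]
  · rintro ⟨hc, hb, ha⟩
    rcases (two_mul_eq_zero_iff h2 _).1 ha with ha | ha
    · exact AddSubgroup.mem_sup_left ((mem_KDelta_iff τ).2 ⟨hc, hb, sub_eq_zero.1 ha⟩)
    · rw [← sub_add_cancel τ (n2 • e2 n1 n2 n3, (0 : G n1 n2 n3), (0 : G n1 n2 n3))]
      refine add_mem (AddSubgroup.mem_sup_left ((mem_KDelta_iff _).2 ?_))
        (halfElement_mem_SGrp n1 n2 n3)
      simp [e2, hc, hb, ← ha]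

theorem index_KDelta_addSubgroupOf_SGrp (n1 n2 n3 : ℕ) (h2 : 0 < n2) :
    ((KDelta n1 n2 n3).addSubgroupOf (SGrp n1 n2 n3)).index = 2 := by
  rw [AddSubgroup.index_eq_two_iff]
  refine ⟨⟨_, halfElement_mem_SGrp n1 n2 n3⟩, ?_⟩
  rintro ⟨τ, hτ⟩
  obtain ⟨hc, hb, ha⟩ := (mem_SGrp_iff h2 τ).1 hτ
  have hn := natCast_half_ne_zero h2
  simp only [AddSubgroup.mem_addSubgroupOf, AddSubgroup.coe_add, mem_KDelta_iff]
  rcases (two_mul_eq_zero_iff h2 _).1 ha with ha | ha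
  · rw [sub_eq_zero] at ha
    simp [e2, hc, hb, ha, hn]
  · have hadd : τ.1.2.1 + n2 = τ.2.2.2.1 := by
      rw [← sub_eq_zero, add_sub_right_comm, ha, ← two_mul, two_mul_natCast_half]
    have hne : τ.1.2.1 ≠ τ.2.2.2.1 := by
      rwa [Ne, ← sub_eq_zero, ha]
    simp [e2, hc, hb, hadd, hne]

/-- Example 2, first case, `Aut_0(X) ≅ ℤ/2`. `S` is the subgroup of `G×G×G`
generated by `KΔ_G` together with `(n2·e2, 0, 0)`, and `S/KΔ_G` is cyclic of order `2`. -/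
theorem stmt5 (n1 n2 n3 : ℕ) (h1 : 0 < n1) (h2 : 0 < n2) (h3 : 0 < n3) :
    S n1 n2 n3 = (SGrp n1 n2 n3 : Set (G n1 n2 n3 × G n1 n2 n3 × G n1 n2 n3)) ∧
    Nonempty
      ((SGrp n1 n2 n3 ⧸ ((KDelta n1 n2 n3).addSubgroupOf (SGrp n1 n2 n3)))
        ≃+ ZMod 2) := by
  refine ⟨Set.ext fun τ => (mem_S_iff h1 h2 h3 τ).trans (mem_SGrp_iff h2 τ).symm, ?_⟩
  have hcard : Nat.card (SGrp n1 n2 n3 ⧸ (KDelta n1 n2 n3).addSubgroupOf (SGrp n1 n2 n3)) = 2 :=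
    index_KDelta_addSubgroupOf_SGrp n1 n2 n3 h2
  have : IsAddCyclic (SGrp n1 n2 n3 ⧸ (KDelta n1 n2 n3).addSubgroupOf (SGrp n1 n2 n3)) :=
    isAddCyclic_of_prime_card hcard
  exact ⟨addEquivOfAddCyclicCardEq (hcard.trans (Nat.card_zmod 2).symm)⟩

end Stmt5
end

section
/- Let n1, n2, n3 be positive integers, let G = ℤ/2n1 × ℤ/2n2 × ℤ/2n3 with standard generators e1 = (1,0,0), e2 = (0,1,0), e3 = (0,0,1), let Ki = ⟨ei⟩ for i = 1,2,3, and let φi be the character of G with φi(x1,x2,x3) = exp(2π√(-1)·xi/(2ni)). Let S = {(τ1,τ2,τ3) ∈ G×G×G : for all integers k1, k2, k3 with k2 and k3 odd, φ2(τ1)^{k2}·φ3(τ1)^{k3}·φ1(τ2)^{k1}·φ3(τ2)^{-k3}·φ1(τ3)^{-k1}·φ2(τ3)^{-k2} = 1}. Then S is the subgroup of G×G×G generated by KΔ_G together with the element (n2·e2, n3·e3, 0), and the quotient group S/KΔ_G is cyclic of order 2. -/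
namespace Stmt6

/-- The group `G = ℤ/2n1 × ℤ/2n2 × ℤ/2n3`. -/
abbrev G (n1 n2 n3 : ℕ) := ZMod (2*n1) × ZMod (2*n2) × ZMod (2*n3)

/-- The character value `exp(2π√(-1)·x/m)` on `ℤ/m`. -/
noncomputable def phi (m : ℕ) (x : ZMod m) : ℂ :=
  Complex.exp (2 * (Real.pi : ℂ) * Complex.I * (x.val : ℂ) / (m : ℂ))

def e1 (n1 n2 n3 : ℕ) : G n1 n2 n3 := (1, 0, 0)
def e2 (n1 n2 n3 : ℕ) : G n1 n2 n3 := (0, 1, 0)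
def e3 (n1 n2 n3 : ℕ) : G n1 n2 n3 := (0, 0, 1)

/-- `KΔ_G`: the subgroup of `G×G×G` generated by `K1×K2×K3` (with `Ki = ⟨ei⟩`) and the
diagonal `Δ_G`. -/
def KDelta (n1 n2 n3 : ℕ) : AddSubgroup (G n1 n2 n3 × G n1 n2 n3 × G n1 n2 n3) :=
  AddSubgroup.closure
    ({x | x.1 ∈ AddSubgroup.closure {e1 n1 n2 n3} ∧
          x.2.1 ∈ AddSubgroup.closure {e2 n1 n2 n3} ∧
          x.2.2 ∈ AddSubgroup.closure {e3 n1 n2 n3}} ∪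
     {x | ∃ g : G n1 n2 n3, x = (g, g, g)})

/-- The set `S` of triples `(τ1,τ2,τ3)` annihilated by all admissible characters
`φ2^{k2}φ3^{k3} ⊗ φ1^{k1}φ3^{-k3} ⊗ φ1^{-k1}φ2^{-k2}` with `k2` and `k3` odd. -/
noncomputable def S (n1 n2 n3 : ℕ) : Set (G n1 n2 n3 × G n1 n2 n3 × G n1 n2 n3) :=
  {τ | ∀ k1 k2 k3 : ℤ, Odd k2 → Odd k3 →
    phi (2*n2) τ.1.2.1 ^ k2 * phi (2*n3) τ.1.2.2 ^ k3 *
    phi (2*n1) τ.2.1.1 ^ k1 * phi (2*n3) τ.2.1.2.2 ^ (-k3) *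
    phi (2*n1) τ.2.2.1 ^ (-k1) * phi (2*n2) τ.2.2.2.1 ^ (-k2) = 1}

/-- The subgroup generated by `KΔ_G` together with `(n2·e2, n3·e3, 0)`. -/
def SGrp (n1 n2 n3 : ℕ) : AddSubgroup (G n1 n2 n3 × G n1 n2 n3 × G n1 n2 n3) :=
  KDelta n1 n2 n3 ⊔ AddSubgroup.closure
    {(n2 • e2 n1 n2 n3, n3 • e3 n1 n2 n3, (0 : G n1 n2 n3))}

theorem mem_KDelta {n1 n2 n3 : ℕ} (x : G n1 n2 n3 × G n1 n2 n3 × G n1 n2 n3) :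
    x ∈ KDelta n1 n2 n3 ↔
      x.2.1.1 = x.2.2.1 ∧ x.1.2.1 = x.2.2.2.1 ∧ x.1.2.2 = x.2.1.2.2 := by
  constructor
  · intro hx
    induction hx using AddSubgroup.closure_induction with
    | mem y hy =>
      rcases hy with ⟨ha, hb, hc⟩ | ⟨g, rfl⟩
      · obtain ⟨i, hi⟩ := AddSubgroup.mem_closure_singleton.1 ha
        obtain ⟨j, hj⟩ := AddSubgroup.mem_closure_singleton.1 hb
        obtain ⟨k, hk⟩ := AddSubgroup.mem_closure_singleton.1 hc
        simp [← hi, ← hj, ← hk, e1, e2, e3]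
      · simp
    | zero => simp
    | add y z _ _ hy hz => simp [hy, hz]
    | neg y _ hy => simp [hy]
  · obtain ⟨⟨a1, a2, a3⟩, ⟨b1, b2, b3⟩, ⟨c1, c2, c3⟩⟩ := x
    rintro ⟨h1, h2, h3⟩
    dsimp only at h1 h2 h3
    subst h1 h2 h3
    have hsplit : (((a1, a2, a3), (b1, b2, a3), (b1, a2, c3)) :
          G n1 n2 n3 × G n1 n2 n3 × G n1 n2 n3) =
        ((a1 - b1, 0, 0), (0, b2 - a2, 0), (0, 0, c3 - a3)) +
          ((b1, a2, a3), (b1, a2, a3), (b1, a2, a3)) := by simp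
    rw [hsplit]
    refine add_mem (AddSubgroup.subset_closure (Or.inl ⟨?_, ?_, ?_⟩))
      (AddSubgroup.subset_closure (Or.inr ⟨(b1, a2, a3), rfl⟩)) <;>
    rw [AddSubgroup.mem_closure_singleton]
    · obtain ⟨k, hk⟩ := ZMod.intCast_surjective (a1 - b1)
      exact ⟨k, by simp [e1, hk]⟩
    · obtain ⟨k, hk⟩ := ZMod.intCast_surjective (b2 - a2)
      exact ⟨k, by simp [e2, hk]⟩
    · obtain ⟨k, hk⟩ := ZMod.intCast_surjective (c3 - a3)
      exact ⟨k, by simp [e3, hk]⟩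

/-- If `2t` lies in `H`, then `H` together with `t` generates `H ∪ (t + H)`. -/
theorem mem_sup_closure_singleton_iff {A : Type*} [AddCommGroup A] (H : AddSubgroup A) {t : A}
    (ht : t + t ∈ H) (x : A) :
    x ∈ H ⊔ AddSubgroup.closure {t} ↔ x ∈ H ∨ x - t ∈ H := by
  constructor
  · intro hx
    obtain ⟨y, hy, z, hz, rfl⟩ := AddSubgroup.mem_sup.1 hx
    obtain ⟨n, rfl⟩ := AddSubgroup.mem_closure_singleton.1 hz
    rcases Int.even_or_odd' n with ⟨k, rfl | rfl⟩
    · left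
      convert add_mem hy (zsmul_mem ht k) using 2
      module
    · right
      convert add_mem hy (zsmul_mem ht k) using 1
      module
  · have htmem : t ∈ H ⊔ AddSubgroup.closure {t} :=
      AddSubgroup.mem_sup_right (AddSubgroup.subset_closure rfl)
    rintro (h | h)
    · exact AddSubgroup.mem_sup_left h
    · simpa using add_mem (AddSubgroup.mem_sup_left h) htmem

/-- If `2t` lies in `H` but `t` does not, then `H` has index two in the group generated by
`H` and `t`. -/
theorem nonempty_quotient_sup_addEquiv {A : Type*} [AddCommGroup A] (H : AddSubgroup A) {t : A}
    (ht : t + t ∈ H) (ht' : t ∉ H) :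
    Nonempty ((↥(H ⊔ AddSubgroup.closure {t}) ⧸
      H.addSubgroupOf (H ⊔ AddSubgroup.closure {t})) ≃+ ZMod 2) := by
  have htmem : t ∈ H ⊔ AddSubgroup.closure {t} :=
    AddSubgroup.mem_sup_right (AddSubgroup.subset_closure rfl)
  have hindex : (H.addSubgroupOf (H ⊔ AddSubgroup.closure {t})).index = 2 := by
    rw [AddSubgroup.index_eq_two_iff]
    refine ⟨⟨t, htmem⟩, ?_⟩
    rintro ⟨b, hb⟩
    simp only [AddSubgroup.mem_addSubgroupOf, AddSubgroup.coe_add]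
    by_cases hbH : b ∈ H
    · exact Or.inr ⟨hbH, fun h => ht' ((AddSubgroup.add_mem_cancel_left H hbH).1 h)⟩
    · have h := ((mem_sup_closure_singleton_iff H ht b).1 hb).resolve_left hbH
      refine Or.inl ⟨?_, hbH⟩
      convert add_mem h ht using 1
      abel
  have : Fact (Nat.Prime 2) := ⟨Nat.prime_two⟩
  exact ⟨addEquivOfPrimeCardEq (p := 2) hindex (Nat.card_zmod 2)⟩

theorem phi_eq_stdAddChar {m : ℕ} [NeZero m] (x : ZMod m) : phi m x = ZMod.stdAddChar x := by
  rw [ZMod.stdAddChar_apply, ZMod.toCircle_apply, phi]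

theorem natCast_half_ne_zero {n : ℕ} (hn : 0 < n) : (n : ZMod (2 * n)) ≠ 0 := by
  rw [Ne, ZMod.natCast_eq_zero_iff]
  intro h
  have := Nat.le_of_dvd hn h
  omega

theorem natCast_half_add_self (n : ℕ) : (n : ZMod (2 * n)) + n = 0 := by
  have h := ZMod.natCast_self (2 * n)
  push_cast at h
  rw [← two_mul, h]

theorem stdAddChar_natCast_half {n : ℕ} [NeZero (2 * n)] (hn : 0 < n) :
    ZMod.stdAddChar (n : ZMod (2 * n)) = -1 := by
  have hsq : ZMod.stdAddChar (n : ZMod (2 * n)) * ZMod.stdAddChar (n : ZMod (2 * n)) = 1 := by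
    rw [← AddChar.map_add_eq_mul, natCast_half_add_self, AddChar.map_zero_eq_one]
  refine (mul_self_eq_one_iff.1 hsq).resolve_left fun h => natCast_half_ne_zero hn ?_
  exact ZMod.injective_stdAddChar (h.trans (AddChar.map_zero_eq_one _).symm)

theorem stdAddChar_eq_one_iff {m : ℕ} [NeZero m] {x : ZMod m} :
    ZMod.stdAddChar x = 1 ↔ x = 0 := by
  rw [← AddChar.map_zero_eq_one (ZMod.stdAddChar (N := m)), ZMod.injective_stdAddChar.eq_iff]

theorem stdAddChar_eq_neg_one_iff {n : ℕ} [NeZero (2 * n)] (hn : 0 < n) {x : ZMod (2 * n)} :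
    ZMod.stdAddChar x = -1 ↔ x = n := by
  rw [← stdAddChar_natCast_half hn, ZMod.injective_stdAddChar.eq_iff]

/-- Elements `u`, `v`, `w` of a field satisfy all the monomial relations with odd exponents on `u` and `v`
exactly when `w = 1` and `u = v = ±1`. -/
theorem forall_odd_zpow_mul_eq_one_iff {F : Type*} [Field F] {u v w : F} :
    (∀ k1 k2 k3 : ℤ, Odd k2 → Odd k3 → u ^ k2 * v ^ k3 * w ^ k1 = 1) ↔
      w = 1 ∧ (u = 1 ∧ v = 1 ∨ u = -1 ∧ v = -1) := by
  constructor
  · intro h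
    have huv : u * v = 1 := by simpa using h 0 1 1 odd_one odd_one
    have hw : w = 1 := by simpa [huv] using h 1 1 1 odd_one odd_one
    have hu3 : u ^ 3 * v = 1 := by
      have h31 := h 0 3 1 (by decide) odd_one
      rwa [zpow_ofNat, zpow_one, zpow_zero, mul_one] at h31
    have husq : u * u = 1 := by linear_combination hu3 - u ^ 2 * huv
    refine ⟨hw, ?_⟩
    rcases mul_self_eq_one_iff.1 husq with rfl | rfl
    · exact Or.inl ⟨rfl, by simpa using huv⟩
    · exact Or.inr ⟨rfl, by linear_combination -huv⟩
  · rintro ⟨rfl, ⟨rfl, rfl⟩ | ⟨rfl, rfl⟩⟩ k1 k2 k3 hk2 hk3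
    · simp
    · simp [hk2.neg_one_zpow, hk3.neg_one_zpow]

theorem mem_S {n1 n2 n3 : ℕ} (h1 : 0 < n1) (h2 : 0 < n2) (h3 : 0 < n3)
    (x : G n1 n2 n3 × G n1 n2 n3 × G n1 n2 n3) :
    x ∈ S n1 n2 n3 ↔ x.2.1.1 - x.2.2.1 = 0 ∧
      (x.1.2.1 - x.2.2.2.1 = 0 ∧ x.1.2.2 - x.2.1.2.2 = 0 ∨
        x.1.2.1 - x.2.2.2.1 = n2 ∧ x.1.2.2 - x.2.1.2.2 = n3) := by
  have : NeZero (2 * n1) := ⟨by omega⟩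
  have : NeZero (2 * n2) := ⟨by omega⟩
  have : NeZero (2 * n3) := ⟨by omega⟩
  rw [← stdAddChar_eq_one_iff, ← stdAddChar_eq_one_iff, ← stdAddChar_eq_one_iff,
    ← stdAddChar_eq_neg_one_iff h2, ← stdAddChar_eq_neg_one_iff h3,
    ← forall_odd_zpow_mul_eq_one_iff]
  simp only [S, Set.mem_ofPred_eq, phi_eq_stdAddChar, AddChar.map_sub_eq_div, zpow_neg,
    div_eq_mul_inv]
  refine forall_congr' fun k1 => forall_congr' fun k2 => forall_congr' fun k3 =>
    imp_congr_right fun _ => imp_congr_right fun _ => ?_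
  simp only [mul_zpow, inv_zpow]
  ring_nf

/-- Example 2, second case, `Aut_0(X) ≅ ℤ/2`. `S` is the subgroup of `G×G×G`
generated by `KΔ_G` together with `(n2·e2, n3·e3, 0)`, and `S/KΔ_G` is cyclic of order `2`. -/
theorem stmt6 (n1 n2 n3 : ℕ) (h1 : 0 < n1) (h2 : 0 < n2) (h3 : 0 < n3) :
    S n1 n2 n3 = (SGrp n1 n2 n3 : Set (G n1 n2 n3 × G n1 n2 n3 × G n1 n2 n3)) ∧
    Nonempty
      ((SGrp n1 n2 n3 ⧸ ((KDelta n1 n2 n3).addSubgroupOf (SGrp n1 n2 n3)))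
        ≃+ ZMod 2) := by
  have htt : ((n2 • e2 n1 n2 n3, n3 • e3 n1 n2 n3, (0 : G n1 n2 n3)) +
      (n2 • e2 n1 n2 n3, n3 • e3 n1 n2 n3, (0 : G n1 n2 n3))) ∈ KDelta n1 n2 n3 := by
    simp [mem_KDelta, e2, e3, natCast_half_add_self]
  have ht : (n2 • e2 n1 n2 n3, n3 • e3 n1 n2 n3, (0 : G n1 n2 n3)) ∉ KDelta n1 n2 n3 := by
    simp [mem_KDelta, e2, e3, natCast_half_ne_zero h2]
  refine ⟨?_, nonempty_quotient_sup_addEquiv _ htt ht⟩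
  ext x
  rw [mem_S h1 h2 h3, SetLike.mem_coe, SGrp, mem_sup_closure_singleton_iff _ htt, mem_KDelta,
    mem_KDelta]
  have hneg : (n3 : ZMod (2 * n3)) = -n3 := eq_neg_of_add_eq_zero_left (natCast_half_add_self n3)
  have hswap2 : x.1.2.1 - x.2.2.2.1 = n2 ↔ x.1.2.1 - n2 = x.2.2.2.1 := by
    rw [sub_eq_iff_eq_add, sub_eq_iff_eq_add, add_comm]
  have hswap3 : x.1.2.2 - x.2.1.2.2 = n3 ↔ x.1.2.2 = x.2.1.2.2 - n3 := by
    rw [sub_eq_iff_eq_add, sub_eq_add_neg, ← hneg, add_comm]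
  rw [hswap2, hswap3]
  simp [e2, e3, sub_eq_zero]
  tauto

end Stmt6
end

section
/- Let n be a positive integer, let G = ℤ/2n × ℤ/2n × ℤ/2n with standard generators e1 = (1,0,0), e2 = (0,1,0), e3 = (0,0,1), let Ki = ⟨ei⟩ for i = 1,2,3, and let φi be the character of G with φi(x1,x2,x3) = exp(2π√(-1)·xi/(2n)). Let S = {(τ1,τ2,τ3) ∈ G×G×G : for all odd integers k2, φ2(τ1)^{k2}·φ2(τ3)^{-k2} = 1, and for all odd integers k3, φ3(τ1)^{k3}·φ3(τ2)^{-k3} = 1}. Then S is the subgroup of G×G×G generated by KΔ_G together with the element (0, e1, 0), and the quotient group S/KΔ_G is cyclic of order 2n, generated by the class of (0, e1, 0). -/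
namespace Stmt7

/-- The group `G = ℤ/2n × ℤ/2n × ℤ/2n`. -/
abbrev G (n : ℕ) := ZMod (2*n) × ZMod (2*n) × ZMod (2*n)

/-- The character value `exp(2π√(-1)·x/m)` on `ℤ/m`. -/
noncomputable def phi (m : ℕ) (x : ZMod m) : ℂ :=
  Complex.exp (2 * (Real.pi : ℂ) * Complex.I * (x.val : ℂ) / (m : ℂ))

def e1 (n : ℕ) : G n := (1, 0, 0)
def e2 (n : ℕ) : G n := (0, 1, 0)
def e3 (n : ℕ) : G n := (0, 0, 1)

/-- `KΔ_G`: the subgroup of `G×G×G` generated by `K1×K2×K3` (with `Ki = ⟨ei⟩`) and the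
diagonal `Δ_G`. -/
def KDelta (n : ℕ) : AddSubgroup (G n × G n × G n) :=
  AddSubgroup.closure
    ({x | x.1 ∈ AddSubgroup.closure {e1 n} ∧
          x.2.1 ∈ AddSubgroup.closure {e2 n} ∧
          x.2.2 ∈ AddSubgroup.closure {e3 n}} ∪
     {x | ∃ g : G n, x = (g, g, g)})

/-- The set `S` of triples `(τ1,τ2,τ3)` with `φ2(τ1)^{k2}·φ2(τ3)^{-k2} = 1` for all odd `k2`
and `φ3(τ1)^{k3}·φ3(τ2)^{-k3} = 1` for all odd `k3`. -/
noncomputable def S (n : ℕ) : Set (G n × G n × G n) :=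
  {τ | (∀ k2 : ℤ, Odd k2 →
          phi (2*n) τ.1.2.1 ^ k2 * phi (2*n) τ.2.2.2.1 ^ (-k2) = 1) ∧
       (∀ k3 : ℤ, Odd k3 →
          phi (2*n) τ.1.2.2 ^ k3 * phi (2*n) τ.2.1.2.2 ^ (-k3) = 1)}

/-- The subgroup generated by `KΔ_G` together with `(0, e1, 0)`. -/
def SGrp (n : ℕ) : AddSubgroup (G n × G n × G n) :=
  KDelta n ⊔ AddSubgroup.closure {((0 : G n), e1 n, (0 : G n))}

lemma phi_injective (m : ℕ) [NeZero m] : Function.Injective (phi m) := by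
  intro x y h
  apply ZMod.injective_toCircle
  apply Circle.ext
  rw [ZMod.toCircle_apply, ZMod.toCircle_apply]
  exact h

lemma forall_odd_zpow_mul_zpow_neg_eq_one_iff {K : Type*} [Field K] {a b : K} (hb : b ≠ 0) :
    (∀ k : ℤ, Odd k → a ^ k * b ^ (-k) = 1) ↔ a = b := by
  constructor
  · intro h
    have h1 := h 1 odd_one
    rw [zpow_one, zpow_neg, zpow_one] at h1
    exact eq_of_mul_inv_eq_one h1
  · rintro rfl k -
    rw [← zpow_add₀ hb, add_neg_cancel, zpow_zero]

lemma mem_S_iff {n : ℕ} (hn : 0 < n) (τ : G n × G n × G n) :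
    τ ∈ S n ↔ τ.1.2.1 = τ.2.2.2.1 ∧ τ.1.2.2 = τ.2.1.2.2 := by
  have : NeZero (2 * n) := ⟨by omega⟩
  have hne (x : ZMod (2 * n)) : phi (2 * n) x ≠ 0 := Complex.exp_ne_zero _
  simp only [S, Set.mem_ofPred_eq, forall_odd_zpow_mul_zpow_neg_eq_one_iff (hne _),
    (phi_injective (2 * n)).eq_iff]

lemma mem_closure_e1_iff {n : ℕ} (x : G n) :
    x ∈ AddSubgroup.closure {e1 n} ↔ x.2.1 = 0 ∧ x.2.2 = 0 := by
  obtain ⟨a, b, c⟩ := x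
  obtain ⟨k, rfl⟩ := ZMod.intCast_surjective a
  rw [AddSubgroup.mem_closure_singleton]
  constructor
  · rintro ⟨l, h⟩
    simp_all [e1, Prod.ext_iff, eq_comm]
  · rintro ⟨rfl, rfl⟩
    exact ⟨k, by simp [e1]⟩

lemma mem_closure_e2_iff {n : ℕ} (x : G n) :
    x ∈ AddSubgroup.closure {e2 n} ↔ x.1 = 0 ∧ x.2.2 = 0 := by
  obtain ⟨a, b, c⟩ := x
  obtain ⟨k, rfl⟩ := ZMod.intCast_surjective b
  rw [AddSubgroup.mem_closure_singleton]
  constructor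
  · rintro ⟨l, h⟩
    simp_all [e2, Prod.ext_iff, eq_comm]
  · rintro ⟨rfl, rfl⟩
    exact ⟨k, by simp [e2]⟩

lemma mem_closure_e3_iff {n : ℕ} (x : G n) :
    x ∈ AddSubgroup.closure {e3 n} ↔ x.1 = 0 ∧ x.2.1 = 0 := by
  obtain ⟨a, b, c⟩ := x
  obtain ⟨k, rfl⟩ := ZMod.intCast_surjective c
  rw [AddSubgroup.mem_closure_singleton]
  constructor
  · rintro ⟨l, h⟩
    simp_all [e3, Prod.ext_iff, eq_comm]
  · rintro ⟨rfl, rfl⟩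
    exact ⟨k, by simp [e3]⟩

lemma mem_KDelta_iff {n : ℕ} (τ : G n × G n × G n) :
    τ ∈ KDelta n ↔
      τ.1.2.1 = τ.2.2.2.1 ∧ τ.1.2.2 = τ.2.1.2.2 ∧ τ.2.1.1 = τ.2.2.1 := by
  constructor
  · intro h
    induction h using AddSubgroup.closure_induction with
    | mem x hx =>
      rcases hx with ⟨h1, h2, h3⟩ | ⟨g, rfl⟩
      · rw [mem_closure_e1_iff] at h1
        rw [mem_closure_e2_iff] at h2
        rw [mem_closure_e3_iff] at h3
        simp [h1, h2, h3]
      · simp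
    | zero => simp
    | add x y _ _ hx hy => simp [hx, hy]
    | neg x _ hx => simp [hx]
  · obtain ⟨⟨a1, a2, a3⟩, ⟨b1, b2, b3⟩, ⟨c1, c2, c3⟩⟩ := τ
    rintro ⟨h1, h2, h3⟩
    dsimp only at h1 h2 h3
    subst h1 h2 h3
    have hK : (((a1 - b1, 0, 0), (0, b2 - a2, 0), (0, 0, c3 - a3)) : G n × G n × G n)
        ∈ KDelta n := by
      apply AddSubgroup.subset_closure
      left
      simp [mem_closure_e1_iff, mem_closure_e2_iff, mem_closure_e3_iff]
    have hD : (((b1, a2, a3), (b1, a2, a3), (b1, a2, a3)) : G n × G n × G n) ∈ KDelta n :=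
      AddSubgroup.subset_closure (Or.inr ⟨_, rfl⟩)
    simpa using add_mem hK hD

lemma mem_SGrp_iff {n : ℕ} (τ : G n × G n × G n) :
    τ ∈ SGrp n ↔ τ.1.2.1 = τ.2.2.2.1 ∧ τ.1.2.2 = τ.2.1.2.2 := by
  rw [SGrp, AddSubgroup.mem_sup]
  constructor
  · rintro ⟨x, hx, y, hy, rfl⟩
    obtain ⟨k, rfl⟩ := AddSubgroup.mem_closure_singleton.1 hy
    obtain ⟨h1, h2, -⟩ := (mem_KDelta_iff x).1 hx
    simp [h1, h2, e1]
  · rintro ⟨h1, h2⟩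
    obtain ⟨k, hk⟩ := ZMod.intCast_surjective (τ.2.1.1 - τ.2.2.1)
    refine ⟨τ - k • ((0 : G n), e1 n, (0 : G n)), ?_, k • ((0 : G n), e1 n, (0 : G n)),
      AddSubgroup.mem_closure_singleton.2 ⟨k, rfl⟩, sub_add_cancel _ _⟩
    rw [mem_KDelta_iff]
    simp [h1, h2, e1, hk]

/-- The homomorphism `(τ1, τ2, τ3) ↦ x1(τ2) - x1(τ3)`, which cuts out `KΔ_G` in `S`. -/
def firstCoordDiff (n : ℕ) : SGrp n →+ ZMod (2 * n) where
  toFun τ := τ.1.2.1.1 - τ.1.2.2.1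
  map_zero' := by simp
  map_add' x y := by simp only [AddSubgroup.coe_add, Prod.fst_add, Prod.snd_add]; abel

lemma ker_firstCoordDiff (n : ℕ) :
    (firstCoordDiff n).ker = (KDelta n).addSubgroupOf (SGrp n) := by
  ext ⟨τ, hτ⟩
  have h := (mem_SGrp_iff τ).1 hτ
  simp [AddSubgroup.mem_addSubgroupOf, mem_KDelta_iff, firstCoordDiff, h, sub_eq_zero]

lemma e1_mem_SGrp (n : ℕ) : ((0 : G n), e1 n, (0 : G n)) ∈ SGrp n := by
  simp [mem_SGrp_iff, e1]

lemma firstCoordDiff_zsmul_e1 (n : ℕ) (k : ℤ) :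
    firstCoordDiff n (k • ⟨_, e1_mem_SGrp n⟩) = k := by
  rw [map_zsmul]
  simp [firstCoordDiff, e1]

lemma firstCoordDiff_surjective (n : ℕ) : Function.Surjective (firstCoordDiff n) := by
  intro a
  obtain ⟨k, rfl⟩ := ZMod.intCast_surjective a
  exact ⟨_, firstCoordDiff_zsmul_e1 n k⟩

/-- Example 3, `Aut_0(Z_n) ≅ ℤ/2n`. `S` is the subgroup of `G×G×G`
generated by `KΔ_G` together with `(0, e1, 0)`, and `S/KΔ_G` is cyclic of order `2n`,
generated by the class of `(0, e1, 0)`. -/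
theorem stmt7 (n : ℕ) (hn : 0 < n) :
    S n = (SGrp n : Set (G n × G n × G n)) ∧
    ∃ h : ((0 : G n), e1 n, (0 : G n)) ∈ SGrp n,
      (∀ q : SGrp n ⧸ (KDelta n).addSubgroupOf (SGrp n),
        q ∈ AddSubgroup.zmultiples
          (QuotientAddGroup.mk (⟨((0 : G n), e1 n, (0 : G n)), h⟩ : SGrp n))) ∧
      Nat.card (SGrp n ⧸ (KDelta n).addSubgroupOf (SGrp n)) = 2 * n := by
  refine ⟨?_, e1_mem_SGrp n, ?_, ?_⟩
  · ext τ
    rw [mem_S_iff hn, SetLike.mem_coe, mem_SGrp_iff]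
  · intro q
    obtain ⟨s, rfl⟩ := QuotientAddGroup.mk_surjective q
    obtain ⟨k, hk⟩ := ZMod.intCast_surjective (firstCoordDiff n s)
    refine AddSubgroup.mem_zmultiples_iff.2 ⟨k, ?_⟩
    rw [← QuotientAddGroup.mk_zsmul, QuotientAddGroup.eq, ← ker_firstCoordDiff,
      AddMonoidHom.mem_ker, map_add, map_neg, firstCoordDiff_zsmul_e1, hk, neg_add_cancel]
  · rw [← ker_firstCoordDiff, Nat.card_congr (QuotientAddGroup.quotientKerEquivOfSurjective _
      (firstCoordDiff_surjective n)).toEquiv, Nat.card_zmod]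

end Stmt7
end
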